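/- Finite-horizon action discretization error bound: let V*_H(b) = StopVal(b) and V*_t = T^Θ V*_{t+1} for t < H, and let V^h_H(b) = StopVal(b) and V^h_t = T^{Θ^h} V^h_{t+1} for t < H. Assume that for each t = 0,…,H−1 there is a constant K_t ≥ 0 with |G(b,θ;V*_{t+1}) − G(b,θ';V*_{t+1})| ≤ K_t·d_Θ(θ,θ') for all b ∈ Δ_M and θ,θ' ∈ Θ. Then for every t = 0,…,H, sup_{b∈Δ_M} |V*_t(b) − V^h_t(b)| ≤ δ_A · Σ_{s=t}^{H−1} K_s. -/

import Mathlib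

open Finset ComplexOrder

/-- The belief simplex `Δ_M ⊆ ℝ^M`. -/
def simplex (M : ℕ) : Set (Fin M → ℝ) :=
  {b | (∀ i, 0 ≤ b i) ∧ ∑ i, b i = 1}

/-- The real number `Re Tr(E ρ)`, the Born-rule likelihood value. -/
noncomputable def trRe {d : ℕ} (E ρ : Matrix (Fin d) (Fin d) ℂ) : ℝ :=
  ((E * ρ).trace).re

/-- Observation probability `ObsProb(o | b, a) = Σ_j b j · Tr(E_o^{(a)} ρ_j)`. -/
noncomputable def obsProb {d M : ℕ} {O A : Type}
    (E : A → O → Matrix (Fin d) (Fin d) ℂ)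
    (ρ : Fin M → Matrix (Fin d) (Fin d) ℂ)
    (o : O) (b : Fin M → ℝ) (a : A) : ℝ :=
  ∑ j, b j * trRe (E a o) (ρ j)

/-- Bayesian posterior `τ(b,a,o)(i) = b i · Tr(E_o^{(a)} ρ_i) / ObsProb(o|b,a)`
(junk value when `ObsProb(o|b,a) = 0`, which only ever appears multiplied by a zero
observation probability). -/
noncomputable def bayes {d M : ℕ} {O A : Type}
    (E : A → O → Matrix (Fin d) (Fin d) ℂ)
    (ρ : Fin M → Matrix (Fin d) (Fin d) ℂ)
    (b : Fin M → ℝ) (a : A) (o : O) : Fin M → ℝ :=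
  fun i => b i * trRe (E a o) (ρ i) / obsProb E ρ o b a

/-- Stopping value `StopVal(b) = max_i b i`. -/
noncomputable def stopVal {M : ℕ} [NeZero M] (b : Fin M → ℝ) : ℝ :=
  univ.sup' univ_nonempty b

/-- Continuation functional
`G(b,θ;W) = −c_meas + Σ_o ObsProb(o|b,θ) · W(τ(b,θ,o))`
(outcomes with `ObsProb(o|b,θ) = 0` contribute zero). -/
noncomputable def contG {d M : ℕ} {O Θ : Type} [Fintype O]
    (E : Θ → O → Matrix (Fin d) (Fin d) ℂ)
    (ρ : Fin M → Matrix (Fin d) (Fin d) ℂ)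
    (c : ℝ) (b : Fin M → ℝ) (θ : Θ) (W : (Fin M → ℝ) → ℝ) : ℝ :=
  -c + ∑ o, obsProb E ρ o b θ * W (bayes E ρ b θ o)

/-- The real part of the trace of a product of positive semidefinite matrices is nonnegative. -/
lemma trRe_nonneg {d : ℕ} {A B : Matrix (Fin d) (Fin d) ℂ}
    (hA : A.PosSemidef) (hB : B.PosSemidef) : 0 ≤ trRe A B := by
  obtain ⟨m, v, rfl⟩ := Matrix.posSemidef_iff_eq_sum_vecMulVec.mp hB
  rw [trRe, Matrix.mul_sum, Matrix.trace_sum, Complex.re_sum]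
  refine sum_nonneg fun i _ => ?_
  rw [Matrix.mul_vecMulVec, Matrix.trace_vecMulVec, dotProduct_comm]
  exact (Complex.le_def.mp (hA.dotProduct_mulVec_nonneg (v i))).1

section BeliefUpdate

variable {d M : ℕ} {O Θ : Type}
  {E : Θ → O → Matrix (Fin d) (Fin d) ℂ} {ρ : Fin M → Matrix (Fin d) (Fin d) ℂ}
  {b : Fin M → ℝ} {θ : Θ}

lemma obsProb_nonneg (hρ : ∀ i, (ρ i).PosSemidef) (hE : ∀ o, (E θ o).PosSemidef)
    (hb : b ∈ simplex M) (o : O) : 0 ≤ obsProb E ρ o b θ :=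
  sum_nonneg fun j _ => mul_nonneg (hb.1 j) (trRe_nonneg (hE o) (hρ j))

lemma sum_obsProb [Fintype O] (hρ : ∀ i, (ρ i).trace = 1) (hE : ∑ o, E θ o = 1)
    (hb : b ∈ simplex M) : ∑ o, obsProb E ρ o b θ = 1 := by
  have h (j : Fin M) : ∑ o, trRe (E θ o) (ρ j) = 1 := by
    simp only [trRe]
    rw [← Complex.re_sum, ← Matrix.trace_sum, ← Matrix.sum_mul, hE, one_mul, hρ, Complex.one_re]
  simp only [obsProb]
  rw [sum_comm]
  simp only [← mul_sum, h, mul_one, hb.2]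

lemma bayes_mem_simplex (hρ : ∀ i, (ρ i).PosSemidef) (hE : ∀ o, (E θ o).PosSemidef)
    (hb : b ∈ simplex M) {o : O} (ho : obsProb E ρ o b θ ≠ 0) :
    bayes E ρ b θ o ∈ simplex M := by
  refine ⟨fun i => div_nonneg (mul_nonneg (hb.1 i) (trRe_nonneg (hE o) (hρ i)))
    (obsProb_nonneg hρ hE hb o), ?_⟩
  simp only [bayes]
  rw [← sum_div]
  exact div_self ho

/-- The continuation functional is nonexpansive in the value function, for the supremum distance
over the simplex. -/
lemma abs_contG_sub_contG_le [Fintype O] (hρ : ∀ i, (ρ i).PosSemidef)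
    (hρtr : ∀ i, (ρ i).trace = 1) (hE : ∀ o, (E θ o).PosSemidef) (hEsum : ∑ o, E θ o = 1)
    (hb : b ∈ simplex M) (c : ℝ) {V W : (Fin M → ℝ) → ℝ} {ε : ℝ}
    (h : ∀ x ∈ simplex M, |V x - W x| ≤ ε) :
    |contG E ρ c b θ V - contG E ρ c b θ W| ≤ ε := by
  have hdiff : contG E ρ c b θ V - contG E ρ c b θ W =
      ∑ o, obsProb E ρ o b θ * (V (bayes E ρ b θ o) - W (bayes E ρ b θ o)) := by
    simp only [contG, mul_sub, sum_sub_distrib]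
    ring
  rw [hdiff]
  calc |∑ o, obsProb E ρ o b θ * (V (bayes E ρ b θ o) - W (bayes E ρ b θ o))|
      ≤ ∑ o, |obsProb E ρ o b θ * (V (bayes E ρ b θ o) - W (bayes E ρ b θ o))| :=
        abs_sum_le_sum_abs _ _
    _ ≤ ∑ o, obsProb E ρ o b θ * ε := by
        refine sum_le_sum fun o _ => ?_
        have hnonneg := obsProb_nonneg hρ hE hb o
        rw [abs_mul, abs_of_nonneg hnonneg]
        by_cases ho : obsProb E ρ o b θ = 0
        · simp [ho]
        · exact mul_le_mul_of_nonneg_left (h _ (bayes_mem_simplex hρ hE hb ho)) hnonneg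
    _ = ε := by rw [← sum_mul, sum_obsProb hρtr hEsum hb, one_mul]

end BeliefUpdate

/-- If `f` is `K`-Lipschitz, `g` is within `ε` of `f`, and the finite set `s` is a `δ`-net, then
`⨆ f` is within `ε + K * δ` of the maximum of `g` over `s`. -/
lemma abs_iSup_sub_sup'_le {X : Type*} [PseudoMetricSpace X] {f g : X → ℝ} {s : Finset X}
    (hs : s.Nonempty) {K δ ε : ℝ} (hK : 0 ≤ K) (hδ : ∀ x, ∃ y ∈ s, dist x y ≤ δ)
    (hf : ∀ x y, |f x - f y| ≤ K * dist x y) (hfg : ∀ x, |f x - g x| ≤ ε) :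
    |(⨆ x, f x) - s.sup' hs g| ≤ ε + K * δ := by
  have : Nonempty X := ⟨hs.choose⟩
  have hle (x : X) : f x ≤ s.sup' hs g + (ε + K * δ) := by
    obtain ⟨y, hy, hxy⟩ := hδ x
    linarith [(abs_le.mp (hf x y)).2, (abs_le.mp (hfg y)).2, le_sup' g hy,
      mul_le_mul_of_nonneg_left hxy hK]
  have hbdd : BddAbove (Set.range f) := ⟨_, Set.forall_mem_range.mpr hle⟩
  have hδ0 : 0 ≤ δ := by
    obtain ⟨y, -, hy⟩ := hδ hs.choose
    exact dist_nonneg.trans hy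
  have hsup : s.sup' hs g ≤ (⨆ x, f x) + ε :=
    sup'_le hs g fun y _ => by linarith [(abs_le.mp (hfg y)).1, le_ciSup hbdd y]
  rw [abs_le]
  constructor
  · linarith [mul_nonneg hK hδ0]
  · linarith [ciSup_le hle]

/-- Finite-horizon action discretization error bound: with
`V*_H = StopVal`, `V*_t = T^Θ V*_{t+1}`, `V^h_H = StopVal`, `V^h_t = T^{Θ^h} V^h_{t+1}`,
and constants `K_t ≥ 0` such that `G(b,·;V*_{t+1})` is `K_t`-Lipschitz in the action
parameter uniformly in `b ∈ Δ_M`, one has for every `t = 0,…,H`: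
`sup_{b∈Δ_M} |V*_t(b) − V^h_t(b)| ≤ δ_A · Σ_{s=t}^{H−1} K_s`. -/
theorem finite_horizon_action_discretization
    (d M : ℕ) (hd : 0 < d) [NeZero M]
    (O : Type) [Fintype O] [Nonempty O]
    (Θ : Type) [MetricSpace Θ]
    (ρ : Fin M → Matrix (Fin d) (Fin d) ℂ)
    (hρpsd : ∀ i, (ρ i).PosSemidef) (hρtr : ∀ i, (ρ i).trace = 1)
    (E : Θ → O → Matrix (Fin d) (Fin d) ℂ)
    (hEpsd : ∀ θ o, (E θ o).PosSemidef) (hEsum : ∀ θ, ∑ o, E θ o = 1)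
    (c : ℝ)
    (Θh : Finset Θ) (hΘh : Θh.Nonempty)
    (δA : ℝ) (hδA : ∀ θ : Θ, ∃ θb ∈ Θh, dist θ θb ≤ δA)
    (H : ℕ)
    (Vstar : ℕ → (Fin M → ℝ) → ℝ)
    (hVstarH : ∀ b ∈ simplex M, Vstar H b = stopVal b)
    (hVstarRec : ∀ t < H, ∀ b ∈ simplex M,
      Vstar t b = max (stopVal b) (⨆ θ : Θ, contG E ρ c b θ (Vstar (t + 1))))
    (Vh : ℕ → (Fin M → ℝ) → ℝ)
    (hVhH : ∀ b ∈ simplex M, Vh H b = stopVal b)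
    (hVhRec : ∀ t < H, ∀ b ∈ simplex M,
      Vh t b = max (stopVal b) (Θh.sup' hΘh fun θb => contG E ρ c b θb (Vh (t + 1))))
    (K : ℕ → ℝ) (hK0 : ∀ t, 0 ≤ K t)
    (hKLip : ∀ t < H, ∀ b ∈ simplex M, ∀ θ θ' : Θ,
      |contG E ρ c b θ (Vstar (t + 1)) - contG E ρ c b θ' (Vstar (t + 1))|
        ≤ K t * dist θ θ') :
    ∀ t ≤ H, ∀ b ∈ simplex M,
      |Vstar t b - Vh t b| ≤ δA * ∑ s ∈ Finset.Ico t H, K s := by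
  intro t ht
  induction ht using Nat.decreasingInduction with
  | self =>
    intro b hb
    simp [hVstarH b hb, hVhH b hb]
  | of_succ t ht ih =>
    intro b hb
    rw [hVstarRec t ht b hb, hVhRec t ht b hb, max_comm (stopVal b), max_comm (stopVal b)]
    refine (abs_max_sub_max_le_abs _ _ _).trans ?_
    refine (abs_iSup_sub_sup'_le hΘh (hK0 t) hδA (hKLip t ht b hb) fun θ =>
      abs_contG_sub_contG_le hρpsd hρtr (hEpsd θ) (hEsum θ) hb c ih).trans_eq ?_
    rw [sum_eq_sum_Ico_succ_bot ht]
    ring
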